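/- Assume the solution is nontrivial (S is not a horizontal line) and u² + v² ≠ 0 at every point of the closure of Ω. Then maxη − minη > (max_B P − min_B P)/g, where max_B P and min_B P denote the maximum and minimum of P over the bed B. -/

import Mathlib

open Set

/-- Partial derivative in the horizontal direction. -/
noncomputable def pdX (f : ℝ × ℝ → ℝ) (p : ℝ × ℝ) : ℝ := fderiv ℝ f p (1, 0)

/-- Partial derivative in the vertical direction. -/
noncomputable def pdY (f : ℝ × ℝ → ℝ) (p : ℝ × ℝ) : ℝ := fderiv ℝ f p (0, 1)

/-- A general (possibly overturning, possibly asymmetric) horizontally `2L`-periodic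
steady water wave.  The free surface `S` is the non-self-intersecting `C²` curve
parametrized by `s ↦ (X s, Y s)`, lying above the bed `B = {y = -d}`, and the fluid
domain `Ω` is the open connected `2L`-periodic region whose boundary is `S ∪ B`.
The flow `(u, v)` with pressure `P` solves the steady Euler equations in `Ω`, is
tangent to `S`, has `P = Patm` on `S` and `v = 0` on `B`; `ψ` is a stream function,
vanishing on `S` and equal to the constant `m` on `B`. -/
structure GenPeriodicFlow (g Patm L d : ℝ) : Type where
  X : ℝ → ℝ
  Y : ℝ → ℝ
  T : ℝ
  u : ℝ × ℝ → ℝ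
  v : ℝ × ℝ → ℝ
  P : ℝ × ℝ → ℝ
  ψ : ℝ × ℝ → ℝ
  m : ℝ
  Ω : Set (ℝ × ℝ)
  T_pos : 0 < T
  X_smooth : ContDiff ℝ 2 X
  Y_smooth : ContDiff ℝ 2 Y
  regular : ∀ s, deriv X s ^ 2 + deriv Y s ^ 2 ≠ 0
  X_per : ∀ s, X (s + T) = X s + 2 * L
  Y_per : ∀ s, Y (s + T) = Y s
  S_above_bed : ∀ s, -d < Y s
  S_simple : ∀ s s', X s = X s' → Y s = Y s' → ∃ n : ℤ, s' = s + n * T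
  Ω_open : IsOpen Ω
  Ω_conn : IsConnected Ω
  Ω_per : ∀ p : ℝ × ℝ, p ∈ Ω ↔ (p.1 + 2 * L, p.2) ∈ Ω
  Ω_frontier : frontier Ω = (range fun s => (X s, Y s)) ∪ {p : ℝ × ℝ | p.2 = -d}
  u_smooth : ContDiff ℝ 1 u
  v_smooth : ContDiff ℝ 1 v
  P_smooth : ContDiff ℝ 2 P
  ψ_smooth : ContDiff ℝ 2 ψ
  u_periodic : ∀ x y, u (x + 2 * L, y) = u (x, y)
  v_periodic : ∀ x y, v (x + 2 * L, y) = v (x, y)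
  P_periodic : ∀ x y, P (x + 2 * L, y) = P (x, y)
  euler_x : ∀ p ∈ Ω, u p * pdX u p + v p * pdY u p = -pdX P p
  euler_y : ∀ p ∈ Ω, u p * pdX v p + v p * pdY v p = -(pdY P p) - g
  incompressible : ∀ p ∈ Ω, pdX u p + pdY v p = 0
  surface_pressure : ∀ s, P (X s, Y s) = Patm
  surface_tangency : ∀ s, u (X s, Y s) * deriv Y s = v (X s, Y s) * deriv X s
  bed_kinematic : ∀ x, v (x, -d) = 0
  psi_x : ∀ p ∈ closure Ω, pdX ψ p = -v p
  psi_y : ∀ p ∈ closure Ω, pdY ψ p = u p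
  psi_surface : ∀ s, ψ (X s, Y s) = 0
  psi_bed : ∀ x, ψ (x, -d) = m

namespace GenPeriodicFlow

variable {g Patm L d : ℝ}

/-- The vorticity `ω = v_x - u_y`. -/
noncomputable def vort (F : GenPeriodicFlow g Patm L d) (p : ℝ × ℝ) : ℝ :=
  pdX F.v p - pdY F.u p

/-- The free surface `S`, as a subset of the plane. -/
def surf (F : GenPeriodicFlow g Patm L d) : Set (ℝ × ℝ) :=
  range fun s => (F.X s, F.Y s)

/-- The maximal surface height `maxη = max_S y`. -/
noncomputable def maxη (F : GenPeriodicFlow g Patm L d) : ℝ := sSup (range F.Y)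

/-- The minimal surface height `minη = min_S y`. -/
noncomputable def minη (F : GenPeriodicFlow g Patm L d) : ℝ := sInf (range F.Y)

/-- The solution is nontrivial: `S` is not a horizontal line. -/
def Nontrivial' (F : GenPeriodicFlow g Patm L d) : Prop := ∃ s s', F.Y s ≠ F.Y s'

/-- `n` is an outward (non-fluid side) normal to `S` at the parameter `s`:
it is orthogonal to the tangent vector and points out of the fluid. -/
def IsOutwardNormalAt (F : GenPeriodicFlow g Patm L d) (n : ℝ × ℝ) (s : ℝ) : Prop :=
  n.1 * deriv F.X s + n.2 * deriv F.Y s = 0 ∧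
  ∃ t₀ > 0, ∀ t, 0 < t → t < t₀ → (F.X s + t * n.1, F.Y s + t * n.2) ∉ closure F.Ω

end GenPeriodicFlow


open Filter Topology

section Calculus

variable {E F : Type*} [NormedAddCommGroup E] [NormedSpace ℝ E]
  [NormedAddCommGroup F] [NormedSpace ℝ F]

/-- A scalar function vanishing to second order times a locally bounded one has zero derivative. -/
lemma hasFDerivAt_smul_of_zero {f : E → ℝ} {G : E → F} {p : E}
    (hf : HasFDerivAt f (0 : E →L[ℝ] ℝ) p)
    (hp : f p = 0) (hG : ContinuousAt G p) :
    HasFDerivAt (fun x => f x • G x) (0 : E →L[ℝ] F) p := by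
  rw [hasFDerivAt_iff_isLittleO, ← Asymptotics.isLittleO_norm_norm] at hf ⊢
  simp only [hp, sub_zero, zero_smul, zero_apply] at hf ⊢
  have h := hf.mul_isBigO (hG.norm.isBoundedUnder_le.isBigO_one ℝ).norm_left
  simpa only [norm_smul, mul_one] using h

/-- The exterior derivative of `u dv + dw` is `du ∧ dv`, for `u`, `v`, `w` merely `C¹`, at any
point where the one-form is differentiable. -/
lemma curl_smul_fderiv_add_fderiv {u v w : E → ℝ} (hu : ContDiff ℝ 1 u) (hv : ContDiff ℝ 1 v)
    (hw : ContDiff ℝ 1 w) {Θ : E → E →L[ℝ] ℝ} {Θ' : E →L[ℝ] E →L[ℝ] ℝ} {p : E}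
    (hΘ : HasFDerivAt Θ Θ' p) (hΘe : ∀ᶠ x in 𝓝 p, Θ x = u x • fderiv ℝ v x + fderiv ℝ w x)
    (a b : E) :
    Θ' a b - Θ' b a = fderiv ℝ u p a * fderiv ℝ v p b - fderiv ℝ u p b * fderiv ℝ v p a := by
  have du : ∀ x, HasFDerivAt u (fderiv ℝ u x) x := fun x =>
    (hu.differentiable one_ne_zero x).hasFDerivAt
  have dv : ∀ x, HasFDerivAt v (fderiv ℝ v x) x := fun x =>
    (hv.differentiable one_ne_zero x).hasFDerivAt
  have dw : ∀ x, HasFDerivAt w (fderiv ℝ w x) x := fun x =>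
    (hw.differentiable one_ne_zero x).hasFDerivAt
  set U := fderiv ℝ u p with hU
  set V := fderiv ℝ v p with hV
  have dUl : ∀ x, HasFDerivAt (fun x => U (x - p)) U x := fun x =>
    U.hasFDerivAt.comp x ((hasFDerivAt_id x).sub_const p)
  have dVl : ∀ x, HasFDerivAt (fun x => V (x - p)) V x := fun x =>
    V.hasFDerivAt.comp x ((hasFDerivAt_id x).sub_const p)
  let W : E → ℝ := fun x => w x + u p * v x + U (x - p) * (v x - v p - V (x - p))
  let W' : E → E →L[ℝ] ℝ := fun x =>
    fderiv ℝ w x + u p • fderiv ℝ v x +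
      (U (x - p) • (fderiv ℝ v x - V) + (v x - v p - V (x - p)) • U)
  have hW : ∀ x, HasFDerivAt W (W' x) x := fun x =>
    ((dw x).add ((dv x).const_mul (u p))).add
      ((dUl x).mul (((dv x).sub_const (v p)).sub (dVl x)))
  have cv : Continuous (fderiv ℝ v) := hv.continuous_fderiv one_ne_zero
  have h1 : HasFDerivAt (fun x => (u x - u p - U (x - p)) • fderiv ℝ v x)
      (0 : E →L[ℝ] E →L[ℝ] ℝ) p := by
    refine hasFDerivAt_smul_of_zero ?_ (by simp) cv.continuousAt
    have := ((du p).sub_const (u p)).sub (dUl p)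
    rwa [← hU, sub_self] at this
  have h2 : HasFDerivAt (fun x => (v x - v p - V (x - p)) • U)
      (0 : E →L[ℝ] E →L[ℝ] ℝ) p := by
    refine hasFDerivAt_smul_of_zero (G := fun _ => U) ?_ (by simp) continuousAt_const
    have := ((dv p).sub_const (v p)).sub (dVl p)
    rwa [← hV, sub_self] at this
  have h3 : HasFDerivAt (fun x => U (x - p) • V) (U.smulRight V) p := by
    simpa using (dUl p).smul_const V
  have hW2 : HasFDerivAt W' (Θ' - U.smulRight V) p := by
    have h4 := ((hΘ.sub h1).add h2).sub h3
    simp only [sub_zero, add_zero] at h4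
    refine h4.congr_of_eventuallyEq ?_
    filter_upwards [hΘe] with x hx
    simp only [W', Pi.add_apply, Pi.sub_apply, hx]
    module
  have := second_derivative_symmetric_of_eventually (Eventually.of_forall hW) hW2 a b
  simp at this
  linarith

/-- Second order necessary condition at a local maximum, along a direction. -/
lemma IsLocalMax.second_directional_deriv_nonpos {f : E → ℝ} (hf : ContDiff ℝ 2 f) {p : E}
    (hp : IsLocalMax f p) (e : E) : fderiv ℝ (fun q => fderiv ℝ f q e) p e ≤ 0 := by
  have df : Differentiable ℝ f := hf.differentiable two_ne_zero
  have dg : Differentiable ℝ (fun q => fderiv ℝ f q e) :=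
    ((hf.fderiv_right (m := 1) (by norm_num)).clm_apply contDiff_const).differentiable one_ne_zero
  have hl : ∀ t : ℝ, HasDerivAt (fun t : ℝ => p + t • e) e t := fun t => by
    simpa using ((hasDerivAt_id t).smul_const e).const_add p
  let k : ℝ → ℝ := fun t => f (p + t • e)
  have hk : ∀ t, HasDerivAt k (fderiv ℝ f (p + t • e) e) t := fun t =>
    (df _).hasFDerivAt.comp_hasDerivAt t (hl t)
  have hk' : deriv k = fun t => fderiv ℝ f (p + t • e) e := funext fun t => (hk t).deriv
  have hk2 : deriv (deriv k) 0 = fderiv ℝ (fun q => fderiv ℝ f q e) p e := by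
    rw [hk']
    have := ((dg (p + (0 : ℝ) • e)).hasFDerivAt.comp_hasDerivAt 0 (hl 0)).deriv
    simpa [Function.comp_def] using this
  have hmax : IsLocalMax k 0 := by
    have : Tendsto (fun t : ℝ => p + t • e) (𝓝 0) (𝓝 p) := by
      simpa using (hl 0).continuousAt.tendsto
    have h := this.eventually hp
    filter_upwards [h] with t ht
    simpa [k] using ht
  rw [← hk2]
  by_contra! hpos
  have hmin : IsLocalMin k 0 :=
    isLocalMin_of_deriv_deriv_pos hpos hmax.deriv_eq_zero (hk 0).continuousAt
  have hc : k =ᶠ[𝓝 0] fun _ => k 0 := by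
    filter_upwards [hmax, hmin] with t h1 h2 using le_antisymm h1 h2
  have h2 := hc.deriv.deriv_eq
  simp at h2
  linarith

/-- A function maximal at the right end point of an interval has nonnegative derivative there. -/
lemma HasDerivAt.nonneg_of_right_endpoint_max {k : ℝ → ℝ} {k' a b : ℝ} (hab : a < b)
    (hk : HasDerivAt k k' b) (hmax : ∀ t ∈ Icc a b, k t ≤ k b) : 0 ≤ k' := by
  have h := (hasDerivAt_iff_tendsto_slope_left_right.1 hk).1
  refine ge_of_tendsto h ?_
  filter_upwards [Ioo_mem_nhdsLT hab] with t ht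
  rw [slope_def_field]
  have h1 := hmax t ⟨ht.1.le, ht.2.le⟩
  exact div_nonneg_of_nonpos (by linarith) (by linarith [ht.2])

end Calculus

section Hopf

/-- The square of the Euclidean distance in the plane. -/
def sqDist (c p : ℝ × ℝ) : ℝ := (p.1 - c.1) ^ 2 + (p.2 - c.2) ^ 2

lemma continuous_sqDist (c : ℝ × ℝ) : Continuous (sqDist c) := by
  unfold sqDist; fun_prop

/-- The barrier function for Hopf's boundary point lemma. -/
noncomputable def barrier (α : ℝ) (c p : ℝ × ℝ) : ℝ := Real.exp (-α * sqDist c p)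

lemma contDiff_barrier (α : ℝ) (c : ℝ × ℝ) {n : WithTop ℕ∞} : ContDiff ℝ n (barrier α c) := by
  unfold barrier sqDist; fun_prop

lemma fderiv_barrier (α : ℝ) (c p e : ℝ × ℝ) : fderiv ℝ (barrier α c) p e =
    -2 * α * ((p.1 - c.1) * e.1 + (p.2 - c.2) * e.2) * barrier α c p := by
  have h1 : HasFDerivAt (fun p : ℝ × ℝ => p.1 - c.1) (ContinuousLinearMap.fst ℝ ℝ ℝ) p :=
    hasFDerivAt_fst.sub_const _
  have h2 : HasFDerivAt (fun p : ℝ × ℝ => p.2 - c.2) (ContinuousLinearMap.snd ℝ ℝ ℝ) p :=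
    hasFDerivAt_snd.sub_const _
  have h := (((h1.pow 2).add (h2.pow 2)).const_mul (-α)).exp
  rw [show barrier α c = fun x : ℝ × ℝ => Real.exp (-α * ((x.1 - c.1) ^ 2 + (x.2 - c.2) ^ 2)) from
    rfl]
  have h' := h.fderiv
  simp only [Pi.add_apply] at h'
  have := congrArg (fun l => l e) h'
  refine this.trans ?_
  simp
  ring

lemma pdX_pdX_barrier (α : ℝ) (c p : ℝ × ℝ) : pdX (pdX (barrier α c)) p =
    (4 * α ^ 2 * (p.1 - c.1) ^ 2 - 2 * α) * barrier α c p := by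
  have h : pdX (barrier α c) = fun p => (-2 * α * (p.1 - c.1)) * barrier α c p := by
    funext p; simp [pdX, fderiv_barrier]
  have h1 : HasFDerivAt (fun p : ℝ × ℝ => -2 * α * (p.1 - c.1))
      ((-2 * α) • ContinuousLinearMap.fst ℝ ℝ ℝ) p :=
    (hasFDerivAt_fst.sub_const _).const_mul _
  have h2 := h1.mul (((contDiff_barrier α c (n := 1)).differentiable one_ne_zero) p).hasFDerivAt
  have h3 := congrArg (fun l => l (1, 0)) h2.fderiv
  rw [h, pdX]
  refine h3.trans ?_
  simp [fderiv_barrier]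
  ring

lemma pdY_pdY_barrier (α : ℝ) (c p : ℝ × ℝ) : pdY (pdY (barrier α c)) p =
    (4 * α ^ 2 * (p.2 - c.2) ^ 2 - 2 * α) * barrier α c p := by
  have h : pdY (barrier α c) = fun p => (-2 * α * (p.2 - c.2)) * barrier α c p := by
    funext p; simp [pdY, fderiv_barrier]
  have h1 : HasFDerivAt (fun p : ℝ × ℝ => -2 * α * (p.2 - c.2))
      ((-2 * α) • ContinuousLinearMap.snd ℝ ℝ ℝ) p :=
    (hasFDerivAt_snd.sub_const _).const_mul _
  have h2 := h1.mul (((contDiff_barrier α c (n := 1)).differentiable one_ne_zero) p).hasFDerivAt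
  have h3 := congrArg (fun l => l (0, 1)) h2.fderiv
  rw [h, pdY]
  refine h3.trans ?_
  simp [fderiv_barrier]
  ring

lemma contDiff_pdX {f : ℝ × ℝ → ℝ} (hf : ContDiff ℝ 2 f) : ContDiff ℝ 1 (pdX f) :=
  (hf.fderiv_right (m := 1) (by norm_num)).clm_apply contDiff_const

lemma contDiff_pdY {f : ℝ × ℝ → ℝ} (hf : ContDiff ℝ 2 f) : ContDiff ℝ 1 (pdY f) :=
  (hf.fderiv_right (m := 1) (by norm_num)).clm_apply contDiff_const

lemma fderiv_add_const_mul {f h : ℝ × ℝ → ℝ} (hf : Differentiable ℝ f) (hh : Differentiable ℝ h)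
    (ε : ℝ) (p e : ℝ × ℝ) :
    fderiv ℝ (fun q => f q + ε * h q) p e = fderiv ℝ f p e + ε * fderiv ℝ h p e := by
  have := congrArg (fun l => l e) ((hf p).hasFDerivAt.add ((hh p).hasFDerivAt.const_mul ε)).fderiv
  refine this.trans ?_
  simp

set_option maxHeartbeats 1000000 in
/-- **Hopf's boundary point lemma** on a disc. -/
lemma hopf_boundary_point {f : ℝ × ℝ → ℝ} (hf : ContDiff ℝ 2 f) {c x₀ : ℝ × ℝ} {M C : ℝ}
    (hpos : 0 < sqDist c x₀) (hM : f x₀ = M)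
    (hlt : ∀ p, sqDist c p < sqDist c x₀ → f p < M)
    (hell : ∀ p, sqDist c p < sqDist c x₀ →
      |pdX (pdX f) p + pdY (pdY f) p| ≤ C * (|pdX f p| + |pdY f p|)) :
    0 < fderiv ℝ f x₀ (x₀ - c) := by
  set Q := sqDist c x₀ with hQ
  obtain ⟨ρ, hρ, hρQ⟩ : ∃ ρ : ℝ, 0 < ρ ∧ ρ ^ 2 = Q :=
    ⟨√Q, Real.sqrt_pos.2 hpos, Real.sq_sqrt hpos.le⟩
  have hcf : Continuous f := hf.continuous
  have hseg : ∀ (q : ℝ × ℝ) (t : ℝ), sqDist c (c + t • (q - c)) = t ^ 2 * sqDist c q := by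
    intro q t; simp [sqDist]; ring
  -- `f ≤ M` on the closed disc
  have hle : ∀ p, sqDist c p ≤ Q → f p ≤ M := by
    intro p hp
    have ht : Tendsto (fun t : ℝ => f (c + t • (p - c))) (𝓝[<] 1) (𝓝 (f p)) := by
      have : Continuous (fun t : ℝ => f (c + t • (p - c))) := by fun_prop
      have h := this.tendsto 1
      simp only [one_smul, add_sub_cancel] at h
      exact h.mono_left nhdsWithin_le_nhds
    refine le_of_tendsto ht ?_
    filter_upwards [Ioo_mem_nhdsLT (zero_lt_one (α := ℝ))] with t ht
    refine (hlt _ ?_).le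
    rw [hseg]
    have h0 : 0 ≤ sqDist c p := by unfold sqDist; positivity
    have : t ^ 2 < 1 := by nlinarith [ht.1, ht.2]
    nlinarith
  obtain ⟨C', hC'0, hCC'⟩ : ∃ C' : ℝ, 0 ≤ C' ∧ C ≤ C' :=
    ⟨max C 0, le_max_right _ _, le_max_left _ _⟩
  set α : ℝ := 4 * (2 + C' * ρ) / Q with hα
  have hαpos : 0 < α := by positivity
  have hαQ : α * Q = 4 * (2 + C' * ρ) := by rw [hα]; field_simp
  -- gap on the inner circle
  have hcompact : ∀ r : ℝ, IsCompact {p : ℝ × ℝ | sqDist c p ≤ r} := by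
    intro r
    refine Metric.isCompact_of_isClosed_isBounded
      (isClosed_le (continuous_sqDist c) continuous_const) ?_
    refine (Metric.isBounded_closedBall (x := c) (r := 1 + r)).subset ?_
    intro p hp
    simp only [sqDist, mem_ofPred_eq] at hp
    rw [Metric.mem_closedBall, Prod.dist_eq, max_le_iff, Real.dist_eq, Real.dist_eq]
    constructor <;> apply abs_le.2 <;> constructor <;>
      nlinarith [sq_nonneg (p.1 - c.1 - 1), sq_nonneg (p.2 - c.2 - 1), sq_nonneg (p.1 - c.1 + 1),
        sq_nonneg (p.2 - c.2 + 1), sq_nonneg (p.1 - c.1), sq_nonneg (p.2 - c.2)]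
  obtain ⟨p₁, hp₁, hp₁max⟩ := (hcompact (Q / 4)).exists_isMaxOn
    ⟨c, by simp [sqDist]; positivity⟩ hcf.continuousOn
  have hδ : f p₁ < M := hlt _ (lt_of_le_of_lt hp₁ (by linarith))
  set ε := M - f p₁ with hε
  have hεpos : 0 < ε := by linarith
  set h := barrier α c with hh
  set K := Real.exp (-α * Q) with hK
  have hh1 : ∀ p, 0 < h p := fun p => Real.exp_pos _
  have hhle : ∀ p, h p ≤ 1 := fun p => by
    have h0 : 0 ≤ sqDist c p := by unfold sqDist; positivity
    exact Real.exp_le_one_iff.2 (by nlinarith)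
  have hKpos : 0 < K := Real.exp_pos _
  let φ : ℝ × ℝ → ℝ := fun p => f p + ε * h p
  have hφ : ContDiff ℝ 2 φ := hf.add (contDiff_const.mul (contDiff_barrier α c))
  have key : ∀ p, Q / 4 ≤ sqDist c p → sqDist c p ≤ Q → φ p ≤ M + ε * K := by
    set D := {p : ℝ × ℝ | sqDist c p ≤ Q} ∩ {p | Q / 4 ≤ sqDist c p} with hD
    have hDc : IsCompact D :=
      (hcompact Q).inter_right (isClosed_le continuous_const (continuous_sqDist c))
    obtain ⟨p, ⟨hpQ, hpQ4⟩, hpmax⟩ := hDc.exists_isMaxOn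
      ⟨x₀, by rw [mem_ofPred_eq], by rw [mem_ofPred_eq]; linarith⟩ hφ.continuous.continuousOn
    simp only [mem_ofPred_eq] at hpQ hpQ4
    suffices hs : φ p ≤ M + ε * K from fun q h1 h2 => (hpmax ⟨h2, h1⟩ : φ q ≤ φ p).trans hs
    by_contra! hcon
    have hQ1 : sqDist c p < Q := by
      refine lt_of_le_of_ne hpQ fun heq => ?_
      have : h p = K := by simp only [hh, barrier, heq, hK]
      have h1 := hle p hpQ
      simp only [φ, this] at hcon
      linarith
    have hQ2 : Q / 4 < sqDist c p := by
      refine lt_of_le_of_ne hpQ4 fun heq => ?_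
      have h1 : f p ≤ f p₁ := hp₁max (show sqDist c p ≤ Q / 4 from heq.ge)
      have h2 := hhle p
      simp only [φ] at hcon
      nlinarith
    have hDn : D ∈ 𝓝 p := by
      have h1 : {p : ℝ × ℝ | sqDist c p < Q} ∈ 𝓝 p :=
        (isOpen_lt (continuous_sqDist c) continuous_const).mem_nhds hQ1
      have h2 : {p : ℝ × ℝ | Q / 4 < sqDist c p} ∈ 𝓝 p :=
        (isOpen_lt continuous_const (continuous_sqDist c)).mem_nhds hQ2
      filter_upwards [h1, h2] with q h1 h2 using ⟨le_of_lt h1, le_of_lt h2⟩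
    have hloc : IsLocalMax φ p := hpmax.isLocalMax hDn
    have df : Differentiable ℝ f := hf.differentiable two_ne_zero
    have dh : Differentiable ℝ h := (contDiff_barrier α c (n := 1)).differentiable one_ne_zero
    have hX : pdX φ = fun q => pdX f q + ε * pdX h q := by
      funext q; exact fderiv_add_const_mul df dh ε q _
    have hY : pdY φ = fun q => pdY f q + ε * pdY h q := by
      funext q; exact fderiv_add_const_mul df dh ε q _
    have hXX : pdX (pdX f) p + ε * pdX (pdX h) p ≤ 0 := by
      have := hloc.second_directional_deriv_nonpos hφ (1, 0)
      change pdX (pdX φ) p ≤ 0 at this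
      rw [hX] at this
      rwa [pdX, fderiv_add_const_mul ((contDiff_pdX hf).differentiable one_ne_zero)
        ((contDiff_pdX (contDiff_barrier α c)).differentiable one_ne_zero)] at this
    have hYY : pdY (pdY f) p + ε * pdY (pdY h) p ≤ 0 := by
      have := hloc.second_directional_deriv_nonpos hφ (0, 1)
      change pdY (pdY φ) p ≤ 0 at this
      rw [hY] at this
      rwa [pdY, fderiv_add_const_mul ((contDiff_pdY hf).differentiable one_ne_zero)
        ((contDiff_pdY (contDiff_barrier α c)).differentiable one_ne_zero)] at this
    have hX0 : pdX f p + ε * pdX h p = 0 := by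
      have : pdX φ p = 0 := by rw [pdX, hloc.fderiv_eq_zero]; rfl
      rwa [hX] at this
    have hY0 : pdY f p + ε * pdY h p = 0 := by
      have : pdY φ p = 0 := by rw [pdY, hloc.fderiv_eq_zero]; rfl
      rwa [hY] at this
    have hell' := hell p hQ1
    rw [hh, pdX_pdX_barrier] at hXX
    rw [hh, pdY_pdY_barrier] at hYY
    rw [hh, pdX, pdX, fderiv_barrier] at hX0
    rw [hh, pdY, pdY, fderiv_barrier] at hY0
    simp only [mul_one, mul_zero, add_zero, zero_add] at hX0 hY0
    change pdX f p + _ = 0 at hX0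
    change pdY f p + _ = 0 at hY0
    have hb : 0 < barrier α c p := hh1 p
    have hx : |p.1 - c.1| ≤ ρ := abs_le_of_sq_le_sq (by
      rw [hρQ]; unfold sqDist at hpQ; nlinarith [sq_nonneg (p.2 - c.2)]) hρ.le
    have hy : |p.2 - c.2| ≤ ρ := abs_le_of_sq_le_sq (by
      rw [hρQ]; unfold sqDist at hpQ; nlinarith [sq_nonneg (p.1 - c.1)]) hρ.le
    have eX : |pdX f p| = 2 * α * ε * barrier α c p * |p.1 - c.1| := by
      rw [show pdX f p = 2 * α * ε * barrier α c p * (p.1 - c.1) by linarith, abs_mul,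
        abs_of_pos (by positivity)]
    have eY : |pdY f p| = 2 * α * ε * barrier α c p * |p.2 - c.2| := by
      rw [show pdY f p = 2 * α * ε * barrier α c p * (p.2 - c.2) by linarith, abs_mul,
        abs_of_pos (by positivity)]
    have h1 := (abs_le.1 hell').1
    rw [eX, eY] at h1
    have h2 : C * (2 * α * ε * barrier α c p * |p.1 - c.1| + 2 * α * ε * barrier α c p *
        |p.2 - c.2|) ≤ C' * (2 * α * ε * barrier α c p * ρ + 2 * α * ε * barrier α c p * ρ) := by
      gcongr
    have h3 : α * ε * barrier α c p * (4 * α * sqDist c p) ≤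
        α * ε * barrier α c p * (4 + 4 * C' * ρ) := by
      unfold sqDist
      linarith
    have h4 := le_of_mul_le_mul_left h3 (by positivity)
    have h5 : α * Q ≤ 4 * (α * sqDist c p) := by nlinarith
    nlinarith [mul_nonneg hC'0 hρ.le]
  -- compare along the radius through `x₀`
  let k : ℝ → ℝ := fun t => f (c + t • (x₀ - c)) + ε * h (c + t • (x₀ - c))
  have hl : HasDerivAt (fun t : ℝ => c + t • (x₀ - c)) (x₀ - c) 1 := by
    simpa using ((hasDerivAt_id (1 : ℝ)).smul_const (x₀ - c)).const_add c
  have hk : HasDerivAt k (fderiv ℝ φ x₀ (x₀ - c)) 1 := by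
    have hd : HasFDerivAt φ (fderiv ℝ φ x₀) (c + (1 : ℝ) • (x₀ - c)) := by
      simpa using (hφ.differentiable two_ne_zero x₀).hasFDerivAt
    exact hd.comp_hasDerivAt 1 hl
  have hk0 := hk.nonneg_of_right_endpoint_max (a := 1 / 2) (by norm_num) (by
    intro t ht
    have h1 : k 1 = M + ε * K := by
      simp only [k, one_smul, add_sub_cancel, hM, hh, hK, barrier, ← hQ]
    rw [h1]
    have := hseg x₀ t
    have ht2 : t ^ 2 ≤ 1 := by nlinarith [ht.1, ht.2]
    have ht3 : 1 / 4 ≤ t ^ 2 := by nlinarith [ht.1, ht.2]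
    exact key _ (by rw [this]; nlinarith) (by rw [this]; nlinarith))
  have e1 := fderiv_add_const_mul (hf.differentiable two_ne_zero)
    ((contDiff_barrier α c (n := 1)).differentiable one_ne_zero) ε x₀ (x₀ - c)
  change fderiv ℝ φ x₀ (x₀ - c) = _ at e1
  rw [e1, fderiv_barrier] at hk0
  have e2 : (x₀.1 - c.1) * (x₀ - c).1 + (x₀.2 - c.2) * (x₀ - c).2 = Q := by
    simp [hQ, sqDist]; ring
  rw [e2] at hk0
  have : 0 < 2 * α * Q * ε * barrier α c x₀ := by
    have := hh1 x₀
    positivity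
  nlinarith

end Hopf

section MaximumPrinciple

/-- On `Ω`, the Laplacian of `f` is controlled by the gradient, locally uniformly up to the
boundary. -/
def LaplacianControlled (f : ℝ × ℝ → ℝ) (Ω : Set (ℝ × ℝ)) : Prop :=
  ∀ K, IsCompact K → K ⊆ closure Ω → ∃ C, ∀ p ∈ K ∩ Ω,
    |pdX (pdX f) p + pdY (pdY f) p| ≤ C * (|pdX f p| + |pdY f p|)

lemma dist_le_of_sqDist_le {c p : ℝ × ℝ} {r : ℝ} (hr : 0 ≤ r) (h : sqDist c p ≤ r ^ 2) :
    dist p c ≤ r := by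
  unfold sqDist at h
  rw [Prod.dist_eq, max_le_iff, Real.dist_eq, Real.dist_eq]
  exact ⟨abs_le_of_sq_le_sq (by nlinarith [sq_nonneg (p.2 - c.2)]) hr,
    abs_le_of_sq_le_sq (by nlinarith [sq_nonneg (p.1 - c.1)]) hr⟩

lemma sqDist_le_of_dist_le {c p : ℝ × ℝ} {r : ℝ} (h : dist p c ≤ r) :
    sqDist c p ≤ 2 * r ^ 2 := by
  rw [Prod.dist_eq, max_le_iff, Real.dist_eq, Real.dist_eq] at h
  have h1 := sq_le_sq' (abs_le.1 h.1).1 (abs_le.1 h.1).2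
  have h2 := sq_le_sq' (abs_le.1 h.2).1 (abs_le.1 h.2).2
  unfold sqDist
  linarith

lemma sqDist_pos {c p : ℝ × ℝ} (h : c ≠ p) : 0 < sqDist c p := by
  unfold sqDist
  by_contra! hle
  have h1 : p.1 - c.1 = 0 := by nlinarith [sq_nonneg (p.1 - c.1), sq_nonneg (p.2 - c.2)]
  have h2 : p.2 - c.2 = 0 := by nlinarith [sq_nonneg (p.1 - c.1), sq_nonneg (p.2 - c.2)]
  exact h (Prod.ext (by linarith) (by linarith))

lemma eventually_eq_of_interior_max {f : ℝ × ℝ → ℝ} (hf : ContDiff ℝ 2 f) {Ω : Set (ℝ × ℝ)}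
    (hΩ : IsOpen Ω) (hell : LaplacianControlled f Ω) {M : ℝ} (hle : ∀ p ∈ Ω, f p ≤ M)
    {a : ℝ × ℝ} (ha : a ∈ Ω) (hfa : f a = M) : ∀ᶠ c in 𝓝 a, f c = M := by
  obtain ⟨r', hr', hball⟩ := Metric.isOpen_iff.1 hΩ a ha
  set r := r' / 5 with hr
  have hrpos : 0 < r := by positivity
  have hcl : Metric.closedBall a (4 * r) ⊆ Ω :=
    (Metric.closedBall_subset_ball (by rw [hr]; linarith)).trans hball
  filter_upwards [Metric.closedBall_mem_nhds a hrpos] with c hc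
  by_contra hne
  have hK : IsCompact (Metric.closedBall a (4 * r) ∩ {p | f p = M}) :=
    (isCompact_closedBall a (4 * r)).inter_right (isClosed_eq hf.continuous continuous_const)
  obtain ⟨x₀, ⟨hx₀, hfx₀⟩, hmin⟩ := hK.exists_isMinOn
    ⟨a, Metric.mem_closedBall_self (by positivity), hfa⟩ (continuous_sqDist c).continuousOn
  have hx₀2 : sqDist c x₀ ≤ 2 * r ^ 2 := by
    refine (hmin ⟨Metric.mem_closedBall_self (by positivity), hfa⟩ :
      sqDist c x₀ ≤ sqDist c a).trans (sqDist_le_of_dist_le ?_)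
    rw [dist_comm]; exact hc
  have hin : ∀ p, sqDist c p ≤ sqDist c x₀ → p ∈ Metric.closedBall a (4 * r) := by
    intro p hp
    have h1 : dist p c ≤ 2 * r := dist_le_of_sqDist_le (by positivity) (by nlinarith)
    have h2 : dist c a ≤ r := hc
    rw [Metric.mem_closedBall]
    linarith [dist_triangle p c a]
  obtain ⟨C, hC⟩ := hell _ (isCompact_closedBall a (4 * r)) (hcl.trans subset_closure)
  have hpos := hopf_boundary_point hf (c := c) (x₀ := x₀) (M := M) (C := C)
    (sqDist_pos fun h => hne (h ▸ hfx₀)) hfx₀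
    (fun p hp => lt_of_le_of_ne (hle p (hcl (hin p hp.le))) fun heq =>
      absurd (hmin ⟨hin p hp.le, heq⟩ : sqDist c x₀ ≤ sqDist c p) (not_le.2 hp))
    (fun p hp => hC p ⟨hin p hp.le, hcl (hin p hp.le)⟩)
  have hloc : IsLocalMax f x₀ := by
    filter_upwards [hΩ.mem_nhds (hcl hx₀)] with p hp
    rw [show f x₀ = M from hfx₀]
    exact hle p hp
  rw [hloc.fderiv_eq_zero] at hpos
  simp at hpos

/-- **Strong maximum principle.** -/
lemma eq_of_interior_max {f : ℝ × ℝ → ℝ} (hf : ContDiff ℝ 2 f) {Ω : Set (ℝ × ℝ)}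
    (hΩ : IsOpen Ω) (hΩc : IsPreconnected Ω) (hell : LaplacianControlled f Ω) {M : ℝ}
    (hle : ∀ p ∈ Ω, f p ≤ M) {a : ℝ × ℝ} (ha : a ∈ Ω) (hfa : f a = M) : ∀ p ∈ Ω, f p = M := by
  have hopen : IsOpen {p | p ∈ Ω ∧ f p = M} := by
    rw [isOpen_iff_mem_nhds]
    rintro p ⟨hp, hfp⟩
    filter_upwards [hΩ.mem_nhds hp, eventually_eq_of_interior_max hf hΩ hell hle hp hfp]
      with q h1 h2 using ⟨h1, h2⟩
  have hsub := hΩc.subset_of_closure_inter_subset hopen ⟨a, ha, ha, hfa⟩ (by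
    rintro p ⟨hp, hpΩ⟩
    exact ⟨hpΩ, closure_minimal (fun q hq => hq.2)
      (isClosed_eq hf.continuous continuous_const) hp⟩)
  exact fun p hp => (hsub hp).2

end MaximumPrinciple

namespace GenPeriodicFlow

variable {g Patm L d : ℝ} (F : GenPeriodicFlow g Patm L d)

section Geometry

lemma disjoint_frontier_domain : Disjoint F.Ω (frontier F.Ω) :=
  (disjoint_frontier_iff_isOpen.2 F.Ω_open).symm

lemma surface_mem_closure (s : ℝ) : (F.X s, F.Y s) ∈ closure F.Ω :=
  frontier_subset_closure (by rw [F.Ω_frontier]; exact Or.inl ⟨s, rfl⟩)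

lemma bed_mem_closure (x : ℝ) : (x, -d) ∈ closure F.Ω :=
  frontier_subset_closure (by rw [F.Ω_frontier]; exact Or.inr rfl)

lemma surface_not_mem (s : ℝ) : (F.X s, F.Y s) ∉ F.Ω := fun h =>
  disjoint_left.1 F.disjoint_frontier_domain h (by rw [F.Ω_frontier]; exact Or.inl ⟨s, rfl⟩)

lemma above_bed {p : ℝ × ℝ} (hp : p ∈ F.Ω) : -d < p.2 := by
  by_contra! hle
  have hne : ∀ q ∈ F.Ω, q.2 ≠ -d := fun q hq h =>
    disjoint_left.1 F.disjoint_frontier_domain hq (by rw [F.Ω_frontier]; exact Or.inr h)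
  have hsub : F.Ω ⊆ {q : ℝ × ℝ | q.2 < -d} :=
    F.Ω_conn.isPreconnected.subset_of_closure_inter_subset
      (isOpen_lt continuous_snd continuous_const) ⟨p, hp, lt_of_le_of_ne hle (hne p hp)⟩ (by
        rintro q ⟨hq, hqΩ⟩
        have : q.2 ≤ -d := closure_minimal (t := {q : ℝ × ℝ | q.2 ≤ -d})
          (fun q (hq : q.2 < -d) => hq.le) (isClosed_le continuous_snd continuous_const) hq
        exact lt_of_le_of_ne this (hne q hqΩ))
  have h : F.Y 0 ≤ -d := closure_minimal (t := {q : ℝ × ℝ | q.2 ≤ -d})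
    (fun q hq => (show q.2 < -d from hsub hq).le) (isClosed_le continuous_snd continuous_const)
    (F.surface_mem_closure 0)
  linarith [F.S_above_bed 0]

lemma isCompact_range_Y : IsCompact (range F.Y) :=
  Function.Periodic.compact_of_continuous F.Y_per F.T_pos.ne' F.Y_smooth.continuous

lemma minη_le (s : ℝ) : F.minη ≤ F.Y s := csInf_le F.isCompact_range_Y.bddBelow ⟨s, rfl⟩

lemma le_maxη (s : ℝ) : F.Y s ≤ F.maxη := le_csSup F.isCompact_range_Y.bddAbove ⟨s, rfl⟩

lemma neg_d_lt_minη : -d < F.minη := by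
  obtain ⟨s, hs⟩ := F.isCompact_range_Y.sInf_mem (range_nonempty _)
  rw [minη, ← hs]
  exact F.S_above_bed s

/-- The strip between the bed and the lowest trough lies in the fluid domain. -/
lemma strip_subset : {p : ℝ × ℝ | -d < p.2 ∧ p.2 < F.minη} ⊆ F.Ω := by
  have hconv : Convex ℝ {p : ℝ × ℝ | -d < p.2 ∧ p.2 < F.minη} :=
    (convex_Ioo (-d) F.minη).linear_preimage (LinearMap.snd ℝ ℝ ℝ)
  have hne : ({p : ℝ × ℝ | -d < p.2 ∧ p.2 < F.minη} ∩ F.Ω).Nonempty := by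
    obtain ⟨p, hp, hpΩ⟩ := mem_closure_iff.1 (F.bed_mem_closure 0) {p | p.2 < F.minη}
      (isOpen_lt continuous_snd continuous_const) F.neg_d_lt_minη
    exact ⟨p, ⟨F.above_bed hpΩ, hp⟩, hpΩ⟩
  refine hconv.isPreconnected.subset_of_closure_inter_subset F.Ω_open hne ?_
  rintro p ⟨hp, hp1, hp2⟩
  by_contra hpΩ
  have hfr : p ∈ frontier F.Ω := by
    rw [frontier, F.Ω_open.interior_eq]; exact ⟨hp, hpΩ⟩
  rw [F.Ω_frontier] at hfr
  rcases hfr with ⟨s, rfl⟩ | h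
  · exact absurd hp2 (not_lt.2 (F.minη_le s))
  · exact absurd hp1 (by rw [show p.2 = -d from h]; exact lt_irrefl _)

lemma mem_domain_add_int (p : ℝ × ℝ) (n : ℤ) :
    (p.1 + n * (2 * L), p.2) ∈ F.Ω ↔ p ∈ F.Ω := by
  have h : Function.Periodic (fun x => (x, p.2) ∈ F.Ω) (2 * L) := fun x =>
    propext (F.Ω_per (x, p.2)).symm
  exact iff_of_eq (h.int_mul n p.1)

lemma mem_closure_add_int {p : ℝ × ℝ} (hp : p ∈ closure F.Ω) (n : ℤ) :
    (p.1 + n * (2 * L), p.2) ∈ closure F.Ω := by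
  have hc : Continuous (fun p : ℝ × ℝ => (p.1 + n * (2 * L), p.2)) := by fun_prop
  exact map_mem_closure (f := fun p : ℝ × ℝ => (p.1 + n * (2 * L), p.2)) hc hp
    fun q hq => (F.mem_domain_add_int q n).2 hq

end Geometry

section Winding

open Complex

/-- The (unnormalized) winding integral of a closed curve does not change when the point moves
by less than its distance to the curve. -/
lemma winding_integral_eq {γ γ' : ℝ → ℂ} {T : ℝ} (hγ : ∀ s, HasDerivAt γ (γ' s) s)
    (hγ' : Continuous γ') (hT : γ T = γ 0) {z z' : ℂ} (hz : ∀ s, ‖z - z'‖ < ‖γ s - z'‖) :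
    ∫ s in (0 : ℝ)..T, γ' s / (γ s - z) = ∫ s in (0 : ℝ)..T, γ' s / (γ s - z') := by
  have hc : Continuous γ := continuous_iff_continuousAt.2 fun s => (hγ s).continuousAt
  have h1 : ∀ s, γ s - z' ≠ 0 := fun s h => by
    have := hz s; rw [h, norm_zero] at this; exact absurd this (not_lt.2 (norm_nonneg _))
  have h2 : ∀ s, γ s - z ≠ 0 := fun s h => by
    have := hz s; rw [sub_eq_zero.1 h] at this; exact lt_irrefl _ this
  have hslit : ∀ s, (γ s - z) / (γ s - z') ∈ slitPlane := fun s => by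
    have e : (γ s - z) / (γ s - z') = 1 + -((z - z') / (γ s - z')) := by
      field_simp [h1 s]; ring
    rw [e]
    apply mem_slitPlane_of_norm_lt_one
    rw [norm_neg, norm_div]
    exact (div_lt_one (norm_pos_iff.2 (h1 s))).2 (hz s)
  have hd : ∀ s, HasDerivAt (fun s => log ((γ s - z) / (γ s - z')))
      (γ' s / (γ s - z) - γ' s / (γ s - z')) s := fun s => by
    have := (((hγ s).sub_const z).div ((hγ s).sub_const z') (h1 s)).clog_real (hslit s)
    refine this.congr_deriv ?_
    simp only [Pi.div_apply]
    have := h1 s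
    have := h2 s
    field_simp
  have i1 : IntervalIntegrable (fun s => γ' s / (γ s - z)) MeasureTheory.volume 0 T :=
    (hγ'.div (hc.sub continuous_const) h2).intervalIntegrable _ _
  have i2 : IntervalIntegrable (fun s => γ' s / (γ s - z')) MeasureTheory.volume 0 T :=
    (hγ'.div (hc.sub continuous_const) h1).intervalIntegrable _ _
  have := intervalIntegral.integral_eq_sub_of_hasDerivAt (fun s _ => hd s) (i1.sub i2)
  rw [intervalIntegral.integral_sub i1 i2, hT, sub_self] at this
  exact sub_eq_zero.1 this

/-- The winding integral of a closed curve vanishes about points far away. -/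
lemma winding_integral_eq_zero {γ γ' : ℝ → ℂ} {T : ℝ} (hγ : ∀ s, HasDerivAt γ (γ' s) s)
    (hγ' : Continuous γ') (hT : γ T = γ 0) {z : ℂ} (hz : ∀ s, ‖γ s‖ < ‖z‖) :
    ∫ s in (0 : ℝ)..T, γ' s / (γ s - z) = 0 := by
  have hc : Continuous γ := continuous_iff_continuousAt.2 fun s => (hγ s).continuousAt
  have hz0 : z ≠ 0 := norm_pos_iff.1 ((norm_nonneg _).trans_lt (hz 0))
  have h2 : ∀ s, γ s - z ≠ 0 := fun s h => by
    have := hz s; rw [sub_eq_zero.1 h] at this; exact lt_irrefl _ this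
  have hslit : ∀ s, 1 - γ s / z ∈ slitPlane := fun s => by
    rw [sub_eq_add_neg]
    apply mem_slitPlane_of_norm_lt_one
    rw [norm_neg, norm_div]
    exact (div_lt_one (norm_pos_iff.2 hz0)).2 (hz s)
  have hd : ∀ s, HasDerivAt (fun s => log (1 - γ s / z)) (γ' s / (γ s - z)) s := fun s => by
    have := (((hγ s).div_const z).const_sub 1).clog_real (hslit s)
    refine this.congr_deriv ?_
    have := h2 s
    have e : 1 - γ s / z = -(γ s - z) / z := by field_simp; ring
    rw [e]
    field_simp
  have i1 : IntervalIntegrable (fun s => γ' s / (γ s - z)) MeasureTheory.volume 0 T :=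
    (hγ'.div (hc.sub continuous_const) h2).intervalIntegrable _ _
  rw [intervalIntegral.integral_eq_sub_of_hasDerivAt (fun s _ => hd s) i1, hT, sub_self]

/-- The covering map of the plane modulo horizontal translation by `2L` onto the punctured
complex plane. -/
noncomputable def cover (L : ℝ) (p : ℝ × ℝ) : ℂ := exp (Real.pi * I / L * (p.1 + p.2 * I))

lemma continuous_cover (L : ℝ) : Continuous (cover L) := by
  unfold cover; fun_prop

lemma norm_cover (L : ℝ) (p : ℝ × ℝ) : ‖cover L p‖ = Real.exp (-(Real.pi / L * p.2)) := by
  rw [cover, norm_exp]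
  congr 1
  have : (Real.pi * I / L * (p.1 + p.2 * I) : ℂ) =
      ((-(Real.pi / L * p.2) : ℝ) : ℂ) + ((Real.pi / L * p.1 : ℝ) : ℂ) * I := by
    push_cast
    linear_combination (Real.pi / L * p.2 : ℂ) * I_sq
  rw [this]
  simp [-ofReal_neg, -ofReal_mul, -ofReal_div]

lemma norm_cover_lt (hL : 0 < L) {p q : ℝ × ℝ} (h : q.2 < p.2) : ‖cover L p‖ < ‖cover L q‖ := by
  rw [norm_cover, norm_cover]
  have : 0 < Real.pi / L := div_pos Real.pi_pos hL
  exact Real.exp_lt_exp.2 (by nlinarith)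

lemma exists_int_of_cover_eq (hL : 0 < L) {p q : ℝ × ℝ} (h : cover L p = cover L q) :
    ∃ n : ℤ, p = (q.1 + n * (2 * L), q.2) := by
  obtain ⟨n, hn⟩ := exp_eq_exp_iff_exists_int.1 h
  refine ⟨n, ?_⟩
  have hL' : (L : ℂ) ≠ 0 := by exact_mod_cast hL.ne'
  have hpi : (Real.pi : ℂ) ≠ 0 := by exact_mod_cast Real.pi_ne_zero
  have e : (p.1 + p.2 * I : ℂ) = (q.1 + n * (2 * L) : ℝ) + q.2 * I := by
    have hne : (Real.pi * I / L : ℂ) ≠ 0 := by simp [hL', hpi]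
    apply mul_left_cancel₀ hne
    rw [hn]
    push_cast
    field_simp
    ring
  have hre := congrArg re e
  have him := congrArg im e
  simp [-ofReal_add, -ofReal_mul] at hre him
  exact Prod.ext (by simpa using hre) him

lemma cover_surface_ne (hL : 0 < L) {p : ℝ × ℝ} (hp : p ∈ F.Ω) (s : ℝ) :
    cover L (F.X s, F.Y s) - cover L p ≠ 0 := by
  intro h
  obtain ⟨n, rfl⟩ := exists_int_of_cover_eq hL (sub_eq_zero.1 h).symm
  exact F.surface_not_mem s ((F.mem_domain_add_int (F.X s, F.Y s) n).1 hp)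

lemma cover_surface_periodic (hL : 0 < L) :
    Function.Periodic (fun s => cover L (F.X s, F.Y s)) F.T := fun s => by
  have hL' : (L : ℂ) ≠ 0 := by exact_mod_cast hL.ne'
  simp only [F.X_per, F.Y_per, cover]
  refine exp_eq_exp_iff_exists_int.2 ⟨1, ?_⟩
  push_cast
  field_simp
  ring

/-- The fluid domain lies below the highest crest: the surface separates it from the
region above. -/
lemma below_crest (hL : 0 < L) {p : ℝ × ℝ} (hp : p ∈ F.Ω) : p.2 ≤ F.maxη := by
  by_contra! hlt
  let γ : ℝ → ℂ := fun s => cover L (F.X s, F.Y s)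
  let γ' : ℝ → ℂ := fun s =>
    γ s * (Real.pi * I / L * (deriv F.X s + deriv F.Y s * I))
  have hXd : ∀ s, HasDerivAt F.X (deriv F.X s) s := fun s =>
    (F.X_smooth.differentiable two_ne_zero s).hasDerivAt
  have hYd : ∀ s, HasDerivAt F.Y (deriv F.Y s) s := fun s =>
    (F.Y_smooth.differentiable two_ne_zero s).hasDerivAt
  have hγ : ∀ s, HasDerivAt γ (γ' s) s := fun s =>
    (((hXd s).ofReal_comp.add ((hYd s).ofReal_comp.mul_const I)).const_mul
      (Real.pi * I / L : ℂ)).cexp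
  have hγc : Continuous γ := continuous_iff_continuousAt.2 fun s => (hγ s).continuousAt
  have hγ' : Continuous γ' := by
    have h1 := F.X_smooth.continuous_deriv one_le_two
    have h2 := F.Y_smooth.continuous_deriv one_le_two
    fun_prop
  have hper : Function.Periodic γ F.T := F.cover_surface_periodic hL
  have hT : γ F.T = γ 0 := by simpa using hper 0
  let w : ℂ → ℂ := fun z => ∫ s in (0 : ℝ)..F.T, γ' s / (γ s - z)
  have hloc : IsLocallyConstant (fun p : F.Ω => w (cover L p)) := by
    rw [IsLocallyConstant.iff_eventually_eq]
    intro q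
    have hne : ∀ s, 0 < ‖γ s - cover L q‖ := fun s =>
      norm_pos_iff.2 (F.cover_surface_ne hL q.2 s)
    obtain ⟨_, ⟨s₀, rfl⟩, hs₀⟩ := (Function.Periodic.compact_of_continuous
      (f := fun s => ‖γ s - cover L q‖) (fun s => by simp only [hper s]) F.T_pos.ne'
      (by fun_prop)).exists_isLeast (range_nonempty _)
    have hcont : Continuous (fun x : F.Ω => ‖cover L x - cover L q‖) := by
      have := (continuous_cover L).comp (continuous_subtype_val (p := (· ∈ F.Ω)))
      exact (this.sub continuous_const).norm
    have hev := hcont.continuousAt.eventually_lt (x₀ := q) continuousAt_const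
      (by simpa using hne s₀ : ‖cover L q - cover L q‖ < ‖γ s₀ - cover L q‖)
    filter_upwards [hev] with x hx
    exact winding_integral_eq hγ hγ' hT fun s => hx.trans_le (hs₀ ⟨s, rfl⟩)
  have hqΩ : ((0 : ℝ), (-d + F.minη) / 2) ∈ F.Ω :=
    F.strip_subset ⟨by linarith [F.neg_d_lt_minη], by linarith [F.neg_d_lt_minη]⟩
  have : PreconnectedSpace F.Ω := Subtype.preconnectedSpace F.Ω_conn.isPreconnected
  have heq := hloc.apply_eq_of_preconnectedSpace ⟨p, hp⟩ ⟨_, hqΩ⟩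
  have hlow : w (cover L (0, (-d + F.minη) / 2)) = 0 :=
    winding_integral_eq_zero hγ hγ' hT fun s => norm_cover_lt hL (by
      have := F.minη_le s
      have := F.neg_d_lt_minη
      simp only
      linarith)
  have hhigh : w (cover L p) = w 0 := winding_integral_eq hγ hγ' hT fun s => by
    simpa using norm_cover_lt hL (p := p) (q := (F.X s, F.Y s)) ((F.le_maxη s).trans_lt hlt)
  have hzero : w 0 = 2 * Real.pi * I := by
    have e : ∀ s, γ' s / (γ s - 0) = Real.pi * I / L * (deriv F.X s + deriv F.Y s * I) :=
      fun s => by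
        rw [sub_zero]; exact mul_div_cancel_left₀ _ (exp_ne_zero _)
    simp only [w, e]
    have hd : ∀ s, HasDerivAt (fun s => (Real.pi * I / L * (F.X s + F.Y s * I) : ℂ))
        (Real.pi * I / L * (deriv F.X s + deriv F.Y s * I)) s := fun s =>
      ((hXd s).ofReal_comp.add ((hYd s).ofReal_comp.mul_const I)).const_mul
        (Real.pi * I / L : ℂ)
    have h1 := F.X_smooth.continuous_deriv one_le_two
    have h2 := F.Y_smooth.continuous_deriv one_le_two
    rw [intervalIntegral.integral_eq_sub_of_hasDerivAt (fun s _ => hd s)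
      (Continuous.intervalIntegrable (by fun_prop) _ _)]
    have hX := F.X_per 0
    have hY := F.Y_per 0
    rw [zero_add] at hX hY
    rw [hX, hY]
    have hL' : (L : ℂ) ≠ 0 := by exact_mod_cast hL.ne'
    push_cast
    field_simp
    ring
  have hfin : w (cover L p) = w (cover L (0, (-d + F.minη) / 2)) := heq
  rw [hlow, hhigh, hzero] at hfin
  exact two_pi_I_ne_zero hfin

end Winding

section Elliptic

/-- The pressure with its hydrostatic part removed. -/
noncomputable def dynP (p : ℝ × ℝ) : ℝ := F.P p + g * p.2

lemma contDiff_dynP : ContDiff ℝ 2 F.dynP := F.P_smooth.add (contDiff_const.mul contDiff_snd)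

lemma fderiv_dynP (p e : ℝ × ℝ) : fderiv ℝ F.dynP p e = fderiv ℝ F.P p e + g * e.2 := by
  have h := ((F.P_smooth.differentiable two_ne_zero p).hasFDerivAt.add
    ((hasFDerivAt_snd (𝕜 := ℝ) (p := p)).const_mul g)).fderiv
  have := congrArg (fun l => l e) h
  refine this.trans ?_
  simp

lemma pdX_dynP (p : ℝ × ℝ) : pdX F.dynP p = pdX F.P p := by
  simp [pdX, fderiv_dynP]

lemma pdY_dynP (p : ℝ × ℝ) : pdY F.dynP p = pdY F.P p + g := by
  simp [pdY, fderiv_dynP]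

lemma clm_prod_apply (l : ℝ × ℝ →L[ℝ] ℝ) (e : ℝ × ℝ) : l e = l (1, 0) * e.1 + l (0, 1) * e.2 := by
  have h : e = e.1 • ((1, 0) : ℝ × ℝ) + e.2 • ((0, 1) : ℝ × ℝ) := by ext <;> simp
  conv_lhs => rw [h, map_add, map_smul, map_smul]
  simp [mul_comm]

lemma laplacian_dynP {p : ℝ × ℝ} (hp : p ∈ F.Ω) :
    pdX (pdX F.dynP) p + pdY (pdY F.dynP) p =
      2 * (pdX F.u p * pdY F.v p - pdY F.u p * pdX F.v p) := by
  have dX : HasFDerivAt (pdX F.dynP) (fderiv ℝ (pdX F.dynP) p) p :=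
    ((contDiff_pdX F.contDiff_dynP).differentiable one_ne_zero p).hasFDerivAt
  have dY : HasFDerivAt (pdY F.dynP) (fderiv ℝ (pdY F.dynP) p) p :=
    ((contDiff_pdY F.contDiff_dynP).differentiable one_ne_zero p).hasFDerivAt
  have hΘ := (dX.smul_const (ContinuousLinearMap.snd ℝ ℝ ℝ)).sub
    (dY.smul_const (ContinuousLinearMap.fst ℝ ℝ ℝ))
  have h := curl_smul_fderiv_add_fderiv (u := fun x => 2 * F.u x) (v := F.v)
    (w := fun x => -(F.u x * F.v x)) (contDiff_const.mul F.u_smooth) F.v_smooth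
    (F.u_smooth.mul F.v_smooth).neg hΘ (by
      filter_upwards [F.Ω_open.mem_nhds hp] with x hx
      have du := (F.u_smooth.differentiable one_ne_zero x).hasFDerivAt
      have dv := (F.v_smooth.differentiable one_ne_zero x).hasFDerivAt
      have hm : fderiv ℝ (fun x => -(F.u x * F.v x)) x =
        -(F.u x • fderiv ℝ F.v x + F.v x • fderiv ℝ F.u x) := (du.mul dv).neg.fderiv
      rw [hm]
      ext
      all_goals
        have h1 := F.euler_x x hx
        have h2 := F.euler_y x hx
        have h3 := F.incompressible x hx
        have h4 := F.pdX_dynP x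
        have h5 := F.pdY_dynP x
        simp only [pdX, pdY] at h1 h2 h3 h4 h5
        simp [pdX, pdY]
      · linear_combination F.v x * h3 - h5 - h2
      · linear_combination h4 + h1 - F.u x * h3) (1, 0) (0, 1)
  have hu : ∀ e, fderiv ℝ (fun x => 2 * F.u x) p e = 2 * fderiv ℝ F.u p e := fun e => by
    rw [((F.u_smooth.differentiable one_ne_zero p).hasFDerivAt.const_mul 2).fderiv]
    simp
  rw [hu, hu] at h
  simp at h
  simp only [pdX, pdY] at h ⊢
  linarith

lemma continuous_pdX {f : ℝ × ℝ → ℝ} (hf : ContDiff ℝ 1 f) : Continuous (pdX f) :=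
  (hf.continuous_fderiv one_ne_zero).clm_apply continuous_const

lemma continuous_pdY {f : ℝ × ℝ → ℝ} (hf : ContDiff ℝ 1 f) : Continuous (pdY f) :=
  (hf.continuous_fderiv one_ne_zero).clm_apply continuous_const

/-- Away from stagnation points the dynamic pressure solves a linear elliptic equation without
zeroth order term. -/
lemma laplacianControlled_dynP (hstag : ∀ p ∈ closure F.Ω, F.u p ^ 2 + F.v p ^ 2 ≠ 0) :
    LaplacianControlled F.dynP F.Ω := by
  intro K hK hKΩ
  have cu := F.u_smooth.continuous
  have cv := F.v_smooth.continuous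
  have c1 := continuous_pdX F.u_smooth
  have c2 := continuous_pdY F.u_smooth
  have c3 := continuous_pdX F.v_smooth
  let b₁ : ℝ × ℝ → ℝ := fun p =>
    2 * (F.u p * pdX F.u p + F.v p * pdX F.v p) / (F.u p ^ 2 + F.v p ^ 2)
  let b₂ : ℝ × ℝ → ℝ := fun p =>
    2 * (F.u p * pdY F.u p - F.v p * pdX F.u p) / (F.u p ^ 2 + F.v p ^ 2)
  have hb₁ : ContinuousOn b₁ K := ContinuousOn.div (by fun_prop) (by fun_prop)
    fun p hp => hstag p (hKΩ hp)
  have hb₂ : ContinuousOn b₂ K := ContinuousOn.div (by fun_prop) (by fun_prop)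
    fun p hp => hstag p (hKΩ hp)
  obtain ⟨C₁, hC₁⟩ := hK.exists_bound_of_continuousOn hb₁
  obtain ⟨C₂, hC₂⟩ := hK.exists_bound_of_continuousOn hb₂
  refine ⟨max C₁ C₂, ?_⟩
  rintro p ⟨hp, hpΩ⟩
  have e : pdX (pdX F.dynP) p + pdY (pdY F.dynP) p =
      b₁ p * pdX F.dynP p + b₂ p * pdY F.dynP p := by
    rw [F.laplacian_dynP hpΩ, F.pdX_dynP, F.pdY_dynP]
    have h0 := hstag p (hKΩ hp)
    have h1 := F.euler_x p hpΩ
    have h2 := F.euler_y p hpΩ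
    have h3 : pdY F.v p = -pdX F.u p := by linarith [F.incompressible p hpΩ]
    have h4 : pdX F.P p = -(F.u p * pdX F.u p + F.v p * pdY F.u p) := by linarith
    have h5 : pdY F.P p + g = -(F.u p * pdX F.v p - F.v p * pdX F.u p) := by
      rw [h3] at h2; linarith
    rw [h4, h5, h3]
    simp only [b₁, b₂]
    field_simp
    ring
  rw [e]
  have h1 : |b₁ p| ≤ max C₁ C₂ := (hC₁ p hp).trans (le_max_left _ _)
  have h2 : |b₂ p| ≤ max C₁ C₂ := (hC₂ p hp).trans (le_max_right _ _)
  refine (abs_add_le _ _).trans ?_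
  rw [abs_mul, abs_mul, mul_add]
  gcongr

lemma pdY_dynP_bed (x : ℝ) : pdY F.dynP (x, -d) = 0 := by
  have heuler : F.u (x, -d) * pdX F.v (x, -d) + F.v (x, -d) * pdY F.v (x, -d) =
      -(pdY F.P (x, -d)) - g := by
    have cu := F.u_smooth.continuous
    have cv := F.v_smooth.continuous
    have c3 := continuous_pdX F.v_smooth
    have c4 := continuous_pdY F.v_smooth
    have c5 := continuous_pdY (F.P_smooth.of_le one_le_two)
    exact closure_minimal (s := F.Ω) (t := {p | F.u p * pdX F.v p + F.v p * pdY F.v p =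
      -(pdY F.P p) - g}) F.euler_y (isClosed_eq (by fun_prop) (by fun_prop)) (F.bed_mem_closure x)
  have hvx : pdX F.v (x, -d) = 0 := by
    have h1 : HasDerivAt (fun t : ℝ => (t, -d)) ((1 : ℝ), (0 : ℝ)) x :=
      (hasDerivAt_id x).prodMk (hasDerivAt_const x (-d))
    have h2 := ((F.v_smooth.differentiable one_ne_zero (x, -d)).hasFDerivAt).comp_hasDerivAt x h1
    have h3 : (F.v ∘ fun t : ℝ => (t, -d)) = fun _ => 0 := funext F.bed_kinematic
    rw [h3] at h2
    exact h2.unique (hasDerivAt_const x 0)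
  rw [F.bed_kinematic, hvx] at heuler
  rw [F.pdY_dynP]
  linarith

lemma dynP_periodic (x y : ℝ) : F.dynP (x + 2 * L, y) = F.dynP (x, y) := by
  simp [dynP, F.P_periodic]

end Elliptic

/-- A function controlled by its gradient, with vanishing normal derivative on the bed and not
constant on the surface, is smaller on the bed than its supremum on the surface. -/
lemma bed_lt_of_surface_le (hL : 0 < L) {f : ℝ × ℝ → ℝ} (hf : ContDiff ℝ 2 f)
    (hper : ∀ x y, f (x + 2 * L, y) = f (x, y)) (hell : LaplacianControlled f F.Ω)
    (hbed : ∀ x, pdY f (x, -d) = 0) {N : ℝ} (hN : ∀ s, f (F.X s, F.Y s) ≤ N)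
    (hne : ∃ s s', f (F.X s, F.Y s) ≠ f (F.X s', F.Y s')) (x : ℝ) : f (x, -d) < N := by
  have hclosed : closure F.Ω ⊆ {p : ℝ × ℝ | -d ≤ p.2 ∧ p.2 ≤ F.maxη} :=
    closure_minimal (fun p hp => ⟨(F.above_bed hp).le, F.below_crest hL hp⟩)
      ((isClosed_le continuous_const continuous_snd).inter
        (isClosed_le continuous_snd continuous_const))
  have hcomp : IsCompact (Icc (0 : ℝ) (2 * L) ×ˢ Icc (-d) F.maxη ∩ closure F.Ω) :=
    (isCompact_Icc.prod isCompact_Icc).inter_right isClosed_closure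
  have hrep : ∀ p ∈ closure F.Ω, ∃ q ∈ Icc (0 : ℝ) (2 * L) ×ˢ Icc (-d) F.maxη ∩ closure F.Ω,
      f q = f p := by
    intro p hp
    have hperp : Function.Periodic (fun x => f (x, p.2)) (2 * L) := fun x => hper x p.2
    obtain ⟨n, hn, -⟩ := existsUnique_add_zsmul_mem_Ico (by linarith : 0 < 2 * L) p.1 0
    rw [zsmul_eq_mul, zero_add] at hn
    exact ⟨(p.1 + n * (2 * L), p.2), ⟨⟨⟨hn.1, hn.2.le⟩, hclosed (F.mem_closure_add_int hp n)⟩,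
      F.mem_closure_add_int hp n⟩, hperp.int_mul n p.1⟩
  obtain ⟨q₀, hq₀, -⟩ := hrep _ (F.bed_mem_closure 0)
  obtain ⟨p₀, ⟨-, hp₀⟩, hmax'⟩ := hcomp.exists_isMaxOn ⟨q₀, hq₀⟩ hf.continuous.continuousOn
  have hmax : ∀ p ∈ closure F.Ω, f p ≤ f p₀ := fun p hp => by
    obtain ⟨q, hq, hqp⟩ := hrep p hp
    rw [← hqp]
    exact hmax' hq
  have hlt : ∀ p ∈ F.Ω, f p < f p₀ := fun p hp => by
    refine lt_of_le_of_ne (hmax p (subset_closure hp)) fun heq => ?_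
    have hall := eq_of_interior_max hf F.Ω_open F.Ω_conn.isPreconnected hell
      (fun q hq => hmax q (subset_closure hq)) hp heq
    have hall' : ∀ q ∈ closure F.Ω, f q = f p₀ := fun q hq =>
      closure_minimal (t := {q | f q = f p₀}) hall (isClosed_eq hf.continuous continuous_const) hq
    obtain ⟨s, s', hs⟩ := hne
    exact hs ((hall' _ (F.surface_mem_closure s)).trans (hall' _ (F.surface_mem_closure s')).symm)
  have hbedlt : ∀ x, f (x, -d) < f p₀ := fun x => by
    refine lt_of_le_of_ne (hmax _ (F.bed_mem_closure x)) fun heq => ?_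
    have hd := F.neg_d_lt_minη
    set r := (F.minη + d) / 4 with hr
    have hrpos : 0 < r := by rw [hr]; linarith
    set c : ℝ × ℝ := (x, -d + r) with hc
    have hQ : sqDist c (x, -d) = r ^ 2 := by simp [sqDist, hc]
    have hin : ∀ p, sqDist c p < sqDist c (x, -d) → p ∈ F.Ω := fun p hp => by
      rw [hQ] at hp
      have h1 : |p.2 - c.2| < r := abs_lt_of_sq_lt_sq (by
        unfold sqDist at hp; nlinarith [sq_nonneg (p.1 - c.1)]) hrpos.le
      have h2 := abs_lt.1 h1
      simp only [hc] at h2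
      exact F.strip_subset ⟨by linarith [h2.1], by linarith [h2.2]⟩
    obtain ⟨C, hC⟩ := hell (Metric.closedBall c r ∩ closure F.Ω)
      ((isCompact_closedBall c r).inter_right isClosed_closure) inter_subset_right
    have hpos := hopf_boundary_point hf (c := c) (x₀ := (x, -d)) (M := f p₀) (C := C)
      (by rw [hQ]; positivity) heq (fun p hp => hlt p (hin p hp)) (fun p hp =>
        hC p ⟨⟨dist_le_of_sqDist_le hrpos.le (hQ ▸ hp.le), subset_closure (hin p hp)⟩, hin p hp⟩)
    rw [clm_prod_apply, show fderiv ℝ f (x, -d) (0, 1) = 0 from hbed x] at hpos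
    simp [hc] at hpos
  have hfr : p₀ ∈ frontier F.Ω := by
    rw [frontier, F.Ω_open.interior_eq]
    exact ⟨hp₀, fun h => lt_irrefl _ (hlt p₀ h)⟩
  rw [F.Ω_frontier] at hfr
  rcases hfr with ⟨s, hs⟩ | h
  · refine (hbedlt x).trans_le ?_
    rw [← hs]
    exact hN s
  · have := hbedlt p₀.1
    rw [show -d = p₀.2 from h.symm] at this
    exact absurd this (lt_irrefl _)

end GenPeriodicFlow

/-- **Amplitude versus pressure oscillation on the bed.**  For a nontrivial flow with
no stagnation points in the closure of `Ω`, the wave amplitude dominates the pressure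
oscillation along the bed: `maxη − minη > (max_B P − min_B P)/g`. -/
theorem amplitude_gt_bed_pressure_oscillation (g Patm L d : ℝ) (hg : 0 < g) (hL : 0 < L)
    (hd : 0 < d)
    (F : GenPeriodicFlow g Patm L d)
    (hnt : F.Nontrivial')
    (hstag : ∀ p ∈ closure F.Ω, F.u p ^ 2 + F.v p ^ 2 ≠ 0) :
    F.maxη - F.minη >
      (sSup (range fun x => F.P (x, -d)) - sInf (range fun x => F.P (x, -d))) / g := by
  have hP : ∀ s, F.dynP (F.X s, F.Y s) = Patm + g * F.Y s := fun s => by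
    simp [GenPeriodicFlow.dynP, F.surface_pressure]
  have hB : ∀ x, F.P (x, -d) = F.dynP (x, -d) + g * d := fun x => by
    simp [GenPeriodicFlow.dynP]
  have hne : ∃ s s', F.dynP (F.X s, F.Y s) ≠ F.dynP (F.X s', F.Y s') := by
    obtain ⟨s, s', h⟩ := hnt
    refine ⟨s, s', fun heq => h ?_⟩
    rw [hP, hP] at heq
    exact mul_left_cancel₀ hg.ne' (by linarith)
  have hell := F.laplacianControlled_dynP hstag
  have upper : ∀ x, F.dynP (x, -d) < Patm + g * F.maxη :=
    F.bed_lt_of_surface_le hL F.contDiff_dynP F.dynP_periodic hell F.pdY_dynP_bed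
      (fun s => by rw [hP]; nlinarith [F.le_maxη s]) hne
  have hnX : ∀ f : ℝ × ℝ → ℝ, pdX (fun p => -f p) = fun p => -pdX f p := fun f => by
    funext p; simp [pdX]
  have hnY : ∀ f : ℝ × ℝ → ℝ, pdY (fun p => -f p) = fun p => -pdY f p := fun f => by
    funext p; simp [pdY]
  have hell' : LaplacianControlled (fun p => -F.dynP p) F.Ω := by
    intro K hK hKΩ
    obtain ⟨C, hC⟩ := hell K hK hKΩ
    refine ⟨C, fun p hp => ?_⟩
    simpa only [hnX, hnY, abs_neg, ← neg_add] using hC p hp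
  have lower : ∀ x, -F.dynP (x, -d) < -(Patm + g * F.minη) :=
    F.bed_lt_of_surface_le hL F.contDiff_dynP.neg (fun x y => by rw [F.dynP_periodic]) hell'
      (fun x => by simp [hnY, F.pdY_dynP_bed]) (fun s => by rw [hP]; nlinarith [F.minη_le s])
      (by simpa using hne)
  have hK : IsCompact (range fun x => F.P (x, -d)) :=
    Function.Periodic.compact_of_continuous (c := 2 * L) (fun x => F.P_periodic x (-d))
      (by positivity) (F.P_smooth.continuous.comp (by fun_prop))
  obtain ⟨x₁, h₁⟩ := hK.sSup_mem (range_nonempty _)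
  obtain ⟨x₂, h₂⟩ := hK.sInf_mem (range_nonempty _)
  rw [← h₁, ← h₂, gt_iff_lt, div_lt_iff₀ hg]
  simp only [hB]
  linarith [upper x₁, lower x₂]
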